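/- Let n = 2m, q = 2^m, u a generator of μ_{q+1}, a_i ∈ 𝔽_{q²} and s_i integers with 0 ≤ s_i ≤ q for i = 0,…,q, and set α_i = a_i u^{i(1−2s_i)} + a_i^q u^{i(2s_i−1)}. Define f : 𝔽_{q²} → 𝔽₂ by f(0)=0 and f(x) = Tr₁ⁿ(a_i x^{s_i(q−1)+1}) for x ∈ u^i𝔽_q^*. Then for every b ∈ 𝔽_{q²}, the Walsh coefficient Σ_{x}(−1)^{f(x)+Tr₁ⁿ(bx)} equals q·(N(b) − 1), where N(b) = #{i ∈ {0,…,q} : b u^i + b^q u^{−i} = α_i}. Consequently, f is bent if and only if N(b) ∈ {0, 2} for every b ∈ 𝔽_{q²}. -/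

import Mathlib

open scoped Classical

/-- The absolute trace of a field of characteristic 2, as the sum of Frobenius powers. -/
def FTr (F : Type*) [Field F] (k : ℕ) (x : F) : F :=
  ∑ i ∈ Finset.range k, x ^ 2 ^ i

/-- The additive character sign (-1)^y for y in the prime field {0,1}. -/
noncomputable def chi (F : Type*) [Field F] (y : F) : ℤ :=
  if y = 0 then 1 else -1

theorem FTr_add {F : Type*} [Field F] [CharP F 2] (k : ℕ) (x y : F) :
    FTr F k (x + y) = FTr F k x + FTr F k y := by
  simp only [FTr, add_pow_char_pow, Finset.sum_add_distrib]

theorem FTr_sq {F : Type*} [Field F] [CharP F 2] (k : ℕ) (x : F) (hx : x ^ 2 ^ k = x) :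
    FTr F k x ^ 2 = FTr F k x := by
  have h := Finset.sum_range_succ' (fun i => x ^ 2 ^ i) k
  rw [Finset.sum_range_succ] at h
  simp only [hx, pow_zero, pow_one] at h
  unfold FTr
  rw [sum_pow_char, add_right_cancel h]
  exact Finset.sum_congr rfl fun i _ => by rw [pow_succ 2 i, pow_mul]

theorem FTr_eq_zero_or_one {F : Type*} [Field F] [CharP F 2] (k : ℕ) (x : F)
    (hx : x ^ 2 ^ k = x) : FTr F k x = 0 ∨ FTr F k x = 1 := by
  have h : FTr F k x * (FTr F k x - 1) = 0 := by
    linear_combination FTr_sq k x hx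
  rcases mul_eq_zero.mp h with h | h
  · exact Or.inl h
  · exact Or.inr (sub_eq_zero.mp h)

theorem FTr_two_mul {F : Type*} [Field F] [CharP F 2] (m : ℕ) (x : F) :
    FTr F (2 * m) x = FTr F m (x + x ^ 2 ^ m) := by
  rw [FTr_add]
  simp only [FTr]
  rw [two_mul, Finset.sum_range_add]
  simp only [← pow_mul, pow_add]

theorem chi_add_one {F : Type*} [Field F] [CharP F 2] (x : F) (hx : x = 0 ∨ x = 1) :
    chi F (x + 1) = -chi F x := by
  rcases hx with rfl | rfl
  · simp [chi]
  · simp [chi, CharTwo.add_self_eq_zero]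

/-- The trace of degree `m` does not vanish on a set with more than `2 ^ (m - 1)` elements. -/
theorem exists_FTr_ne_zero {F : Type*} [Field F] (m : ℕ) (hm : 1 ≤ m)
    (L : Finset F) (hL : L.card = 2 ^ m) : ∃ y ∈ L, FTr F m y ≠ 0 := by
  by_contra! h
  obtain ⟨k, rfl⟩ : ∃ k, m = k + 1 := ⟨m - 1, by omega⟩
  let p : Polynomial F := ∑ i ∈ Finset.range (k + 1), Polynomial.X ^ 2 ^ i
  have hdeg : p.natDegree ≤ 2 ^ k := by
    refine Polynomial.natDegree_sum_le_of_forall_le _ _ fun i hi => ?_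
    rw [Polynomial.natDegree_X_pow]
    exact Nat.pow_le_pow_right (by norm_num) (by simpa [Nat.lt_succ_iff] using hi)
  have hp : p = 0 := by
    refine Polynomial.eq_zero_of_natDegree_lt_card_of_eval_eq_zero' p L (fun y hy => ?_) ?_
    · simpa [p, Polynomial.eval_finsetSum, FTr] using h y hy
    · rw [hL, pow_succ]
      have := Nat.pow_pos (n := k) (show 0 < 2 by norm_num)
      omega
  have hc : p.coeff 1 = 1 := by
    simp only [p, Polynomial.finsetSum_coeff, Polynomial.coeff_X_pow]
    rw [Finset.sum_eq_single 0]
    · simp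
    · intro i _ hi
      rw [if_neg]
      exact (Nat.one_lt_two_pow hi).ne
    · simp
  simp [hp] at hc

theorem card_filter_pow_eq_one {F : Type*} [Field F] [Fintype F] (q : ℕ) (hq : 2 ≤ q)
    (hF : Fintype.card F = q ^ 2) :
    (Finset.univ.filter fun y : F => y ^ (q - 1) = 1).card = q - 1 := by
  obtain ⟨g, hg⟩ := IsCyclic.exists_ofOrder_eq_natCard (α := Fˣ)
  have hcard : orderOf g = (q - 1) * (q + 1) := by
    rw [hg, Nat.card_eq_fintype_card, Fintype.card_units, hF, mul_comm]
    exact Nat.sq_sub_sq q 1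
  have ho : orderOf ((g : F) ^ (q + 1)) = q - 1 := by
    rw [← Units.val_pow_eq_pow_val, orderOf_units, orderOf_pow_of_dvd (by omega)
      (hcard ▸ Dvd.intro_left _ rfl), hcard]
    exact Nat.mul_div_cancel _ (by omega)
  have hprim := IsPrimitiveRoot.orderOf ((g : F) ^ (q + 1))
  rw [ho] at hprim
  refine Eq.trans (congrArg Finset.card ?_) hprim.card_nthRootsFinset
  ext y
  simp [Polynomial.mem_nthRootsFinset (show 0 < q - 1 by omega)]

theorem filter_pow_eq_self {F : Type*} [Field F] [Fintype F] (q : ℕ) (hq : 2 ≤ q) :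
    (Finset.univ.filter fun y : F => y ^ q = y) =
      insert 0 (Finset.univ.filter fun y : F => y ^ (q - 1) = 1) := by
  ext y
  obtain ⟨k, rfl⟩ : ∃ k, q = k + 1 := ⟨q - 1, by omega⟩
  by_cases hy : y = 0
  · simp [hy]
  · simp [hy, pow_succ]

theorem sum_chi_FTr {F : Type*} [Field F] [Fintype F] [CharP F 2] (m : ℕ) (hm : 1 ≤ m)
    (hF : Fintype.card F = (2 ^ m) ^ 2) (c : F) :
    ∑ y ∈ Finset.univ.filter (fun y : F => y ^ (2 ^ m - 1) = 1), chi F (FTr F (2 * m) (c * y)) =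
      2 ^ m * (if c + c ^ 2 ^ m = 0 then 1 else 0) - 1 := by
  have hq : 2 ≤ 2 ^ m := by simpa using Nat.pow_le_pow_right (n := 2) (by norm_num) hm
  set K := Finset.univ.filter (fun y : F => y ^ (2 ^ m - 1) = 1) with hK
  set L := Finset.univ.filter (fun y : F => y ^ 2 ^ m = y) with hL
  have hLK : L = insert 0 K := filter_pow_eq_self _ hq
  have h0 : (0 : F) ∉ K := by simp [hK, zero_pow (show 2 ^ m - 1 ≠ 0 by omega)]
  have hLcard : L.card = 2 ^ m := by
    rw [hLK, Finset.card_insert_of_notMem h0, card_filter_pow_eq_one _ hq hF]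
    omega
  have hTr : ∀ y ∈ L, FTr F (2 * m) (c * y) = FTr F m ((c + c ^ 2 ^ m) * y) := by
    intro y hy
    rw [FTr_two_mul, mul_pow, (Finset.mem_filter.mp hy).2, add_mul]
  have hsum : ∑ y ∈ L, chi F (FTr F (2 * m) (c * y)) =
      2 ^ m * (if c + c ^ 2 ^ m = 0 then 1 else 0) := by
    split_ifs with hc
    · rw [Finset.sum_congr rfl (g := fun _ => (1 : ℤ))]
      · simp [hLcard]
      · intro y hy
        rw [hTr y hy, hc, zero_mul]
        simp [FTr, chi]
    · have hall : ∀ x : F, x ^ 2 ^ (2 * m) = x := fun x => by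
        have := FiniteField.pow_card x
        rwa [hF, ← pow_mul, mul_comm] at this
      obtain ⟨z, hz, hz0⟩ := exists_FTr_ne_zero m hm L hLcard
      have hd : (c + c ^ 2 ^ m) ^ 2 ^ m = c + c ^ 2 ^ m := by
        rw [add_pow_char_pow, ← pow_mul, ← pow_add, ← two_mul, hall, add_comm]
      set d := c + c ^ 2 ^ m
      have hw : d⁻¹ * z ∈ L := by
        simp only [hL, Finset.mem_filter, Finset.mem_univ, true_and] at hz ⊢
        rw [mul_pow, inv_pow, hd, hz]
      have hw1 : FTr F (2 * m) (c * (d⁻¹ * z)) = 1 := by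
        refine (FTr_eq_zero_or_one _ _ (hall _)).resolve_left ?_
        rwa [hTr _ hw, mul_inv_cancel_left₀ hc]
      have hadd : ∀ y ∈ L, y + d⁻¹ * z ∈ L := by
        intro y hy
        simp only [hL, Finset.mem_filter, Finset.mem_univ, true_and] at hy hw ⊢
        rw [add_pow_char_pow, hy, hw]
      have hneg : ∑ y ∈ L, chi F (FTr F (2 * m) (c * y)) =
          ∑ y ∈ L, -chi F (FTr F (2 * m) (c * y)) := by
        refine Finset.sum_nbij' (fun y => y + d⁻¹ * z) (fun y => y + d⁻¹ * z) hadd hadd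
          ?_ ?_ ?_
        · intro y _
          rw [add_assoc, CharTwo.add_self_eq_zero, add_zero]
        · intro y _
          rw [add_assoc, CharTwo.add_self_eq_zero, add_zero]
        · intro y _
          rw [mul_add, FTr_add, hw1, chi_add_one _ (FTr_eq_zero_or_one _ _ (hall _)), neg_neg]
      rw [Finset.sum_neg_distrib] at hneg
      omega
  rw [← hsum, hLK, Finset.sum_insert h0]
  simp [chi, FTr]

/-- The cosets `u ^ i * 𝔽_q^*`, for `u` of order `q + 1`, partition the nonzero elements. -/
theorem sum_eq_sum_cosets {F : Type*} [Field F] [Fintype F] (q : ℕ) (hq : 2 ≤ q) (heven : Even q)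
    (hF : Fintype.card F = q ^ 2) (u : F) (hu : orderOf u = q + 1) (g : F → ℤ) :
    ∑ x, g x = g 0 + ∑ i : Fin (q + 1),
      ∑ y ∈ Finset.univ.filter (fun y : F => y ^ (q - 1) = 1), g (u ^ (i : ℕ) * y) := by
  have hu0 : u ≠ 0 := by
    rintro rfl
    have := pow_orderOf_eq_one (0 : F)
    rw [hu, zero_pow (by omega)] at this
    exact zero_ne_one this
  set K := Finset.univ.filter (fun y : F => y ^ (q - 1) = 1) with hK
  have hK0 : ∀ y ∈ K, y ≠ 0 := by
    rintro y hy rfl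
    simp [hK, zero_pow (show q - 1 ≠ 0 by omega)] at hy
  have hcop : Nat.Coprime (q + 1) (q - 1) := by
    obtain ⟨k, rfl⟩ := heven
    have h1 : k + k + 1 = (k + k - 1) + 2 := by omega
    rw [h1, Nat.coprime_self_add_left, Nat.coprime_two_left]
    exact ⟨k - 1, by omega⟩
  have hupow : ∀ i j : Fin (q + 1), (u ^ (i : ℕ)) ^ (q - 1) = (u ^ (j : ℕ)) ^ (q - 1) →
      i = j := by
    intro i j h
    rw [← pow_mul, ← pow_mul, (isOfFinOrder_iff_pow_eq_one.mpr
      ⟨q + 1, by omega, hu ▸ pow_orderOf_eq_one u⟩).pow_eq_pow_iff_modEq, hu] at h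
    have h2 := Nat.ModEq.cancel_right_of_coprime hcop h
    exact Fin.ext (h2.eq_of_lt_of_lt i.2 j.2)
  have hinj : Set.InjOn (fun p : Fin (q + 1) × F => u ^ (p.1 : ℕ) * p.2)
      ((Finset.univ : Finset (Fin (q + 1))) ×ˢ K : Finset _) := by
    rintro ⟨i, y⟩ hy ⟨j, z⟩ hz h
    simp only [Finset.coe_product, Set.mem_prod, Finset.mem_coe] at hy hz h
    have hij : i = j := by
      apply hupow
      have h' := congrArg (· ^ (q - 1)) h
      simp only [mul_pow] at h'
      rwa [(Finset.mem_filter.mp hy.2).2, (Finset.mem_filter.mp hz.2).2, mul_one, mul_one] at h'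
    subst hij
    rw [mul_left_cancel₀ (pow_ne_zero _ hu0) h]
  have himg : ((Finset.univ : Finset (Fin (q + 1))) ×ˢ K).image
      (fun p : Fin (q + 1) × F => u ^ (p.1 : ℕ) * p.2) = Finset.univ.erase 0 := by
    apply Finset.eq_of_subset_of_card_le
    · intro x hx
      obtain ⟨p, hp, rfl⟩ := Finset.mem_image.mp hx
      simp only [Finset.mem_erase, Finset.mem_univ, and_true]
      exact mul_ne_zero (pow_ne_zero _ hu0) (hK0 _ (Finset.mem_product.mp hp).2)
    · rw [Finset.card_image_of_injOn hinj, Finset.card_product,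
        Finset.card_erase_of_mem (Finset.mem_univ _), Finset.card_univ, Finset.card_univ, hF,
        Fintype.card_fin, card_filter_pow_eq_one q hq hF]
      exact (Nat.sq_sub_sq q 1).le
  rw [← Finset.add_sum_erase _ _ (Finset.mem_univ (0 : F)), ← himg, Finset.sum_image hinj,
    Finset.sum_product]

/-- Niho branch functions: the Walsh coefficient at b equals q(N(b) - 1) where
N(b) = #{i : b u^i + b^q u^{-i} = α_i}; hence f is bent iff N(b) ∈ {0,2} for all b. -/
theorem stmt_17 (m : ℕ) (hm : 1 ≤ m) (F : Type*) [Field F] [Fintype F]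
    (hF : Fintype.card F = (2 ^ m) ^ 2)
    (u : F) (hu : orderOf u = 2 ^ m + 1)
    (a : Fin (2 ^ m + 1) → F) (s : Fin (2 ^ m + 1) → ℕ) (hs : ∀ i, s i ≤ 2 ^ m)
    (α : Fin (2 ^ m + 1) → F)
    (hα : ∀ i : Fin (2 ^ m + 1),
      α i = a i * u ^ (((i : ℕ) : ℤ) * (1 - 2 * (s i : ℤ))) +
        (a i) ^ (2 ^ m) * u ^ (((i : ℕ) : ℤ) * (2 * (s i : ℤ) - 1)))
    (f : F → F) (hf0 : f 0 = 0)
    (hf : ∀ i : Fin (2 ^ m + 1), ∀ y : F, y ^ (2 ^ m - 1) = 1 →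
      f (u ^ (i : ℕ) * y) =
        FTr F (2 * m) (a i * (u ^ (i : ℕ) * y) ^ (s i * (2 ^ m - 1) + 1)))
    (N : F → ℕ)
    (hN : ∀ b : F, N b = {i : Fin (2 ^ m + 1) |
      b * u ^ (i : ℕ) + b ^ (2 ^ m) * (u ^ (i : ℕ))⁻¹ = α i}.ncard) :
    (∀ b : F, ∑ x : F, chi F (f x + FTr F (2 * m) (b * x)) =
        (2 ^ m : ℤ) * ((N b : ℤ) - 1)) ∧
      ((∀ b : F, |∑ x : F, chi F (f x + FTr F (2 * m) (b * x))| = (2 ^ m : ℤ)) ↔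
        ∀ b : F, N b = 0 ∨ N b = 2) := by
  have hq : 2 ≤ 2 ^ m := by simpa using Nat.pow_le_pow_right (n := 2) (by norm_num) hm
  have : Fact (Nat.Prime 2) := ⟨Nat.prime_two⟩
  have : CharP F 2 := charP_of_card_eq_prime_pow (f := m * 2) (by rw [hF, pow_mul])
  have huq : u ^ (2 ^ m + 1) = 1 := hu ▸ pow_orderOf_eq_one u
  have hu0 : u ≠ 0 := by
    rintro rfl
    simp at huq
  have hinv : u ^ 2 ^ m = u⁻¹ := eq_inv_of_mul_eq_one_left (by rw [← pow_succ, huq])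
  have hfrob : ∀ k : ℤ, (u ^ k) ^ 2 ^ m = u ^ (-k) := fun k => by
    rw [← zpow_natCast, ← zpow_mul, mul_comm, zpow_mul, zpow_natCast, hinv, inv_zpow, zpow_neg]
  have walsh : ∀ b : F, ∑ x : F, chi F (f x + FTr F (2 * m) (b * x)) =
      (2 ^ m : ℤ) * ((N b : ℤ) - 1) := by
    intro b
    have heven : Even (2 ^ m) := (Nat.even_pow.mpr ⟨even_two, by omega⟩)
    rw [sum_eq_sum_cosets (2 ^ m) hq heven hF u hu]
    have hcoset : ∀ i : Fin (2 ^ m + 1),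
        ∑ y ∈ Finset.univ.filter (fun y : F => y ^ (2 ^ m - 1) = 1),
          chi F (f (u ^ (i : ℕ) * y) + FTr F (2 * m) (b * (u ^ (i : ℕ) * y))) =
        2 ^ m * (if b * u ^ (i : ℕ) + b ^ (2 ^ m) * (u ^ (i : ℕ))⁻¹ = α i then 1 else 0) - 1 := by
      intro i
      set c := a i * u ^ (((i : ℕ) : ℤ) * (1 - 2 * (s i : ℤ))) + b * u ^ (i : ℕ) with hc
      have hcq : c + c ^ 2 ^ m =
          α i + (b * u ^ (i : ℕ) + b ^ (2 ^ m) * (u ^ (i : ℕ))⁻¹) := by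
        have h1 : (u ^ (i : ℕ)) ^ 2 ^ m = (u ^ (i : ℕ))⁻¹ := by
          rw [← pow_mul, mul_comm, pow_mul, hinv, inv_pow]
        rw [hc, add_pow_char_pow, mul_pow, mul_pow, hfrob, h1, hα, ← mul_neg, neg_sub]
        ring
      have hiff : b * u ^ (i : ℕ) + b ^ (2 ^ m) * (u ^ (i : ℕ))⁻¹ = α i ↔ c + c ^ 2 ^ m = 0 := by
        rw [hcq, CharTwo.add_eq_zero, eq_comm]
      simp only [hiff]
      rw [← sum_chi_FTr m hm hF c]
      refine Finset.sum_congr rfl fun y hy => ?_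
      have hy1 := (Finset.mem_filter.mp hy).2
      rw [hf i y hy1, ← FTr_add, hc]
      have hye : y ^ (s i * (2 ^ m - 1) + 1) = y := by
        rw [pow_succ, mul_comm (s i), pow_mul, hy1, one_pow, one_mul]
      have hue : (u ^ (i : ℕ)) ^ (s i * (2 ^ m - 1) + 1) =
          u ^ (((i : ℕ) : ℤ) * (1 - 2 * (s i : ℤ))) := by
        have hexp : (((i : ℕ) * (s i * (2 ^ m - 1) + 1) : ℕ) : ℤ) =
            ((i : ℕ) : ℤ) * (1 - 2 * (s i : ℤ)) +
              ((2 ^ m + 1 : ℕ) : ℤ) * (((i : ℕ) : ℤ) * (s i : ℤ)) := by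
          push_cast [Nat.cast_sub (show 1 ≤ 2 ^ m by omega)]
          ring
        rw [← pow_mul, ← zpow_natCast, hexp, zpow_add₀ hu0, zpow_mul u ((2 ^ m + 1 : ℕ) : ℤ),
          zpow_natCast, huq, one_zpow, mul_one]
      rw [mul_pow, hye, hue]
      congr 2
      ring
    rw [Finset.sum_congr rfl fun i _ => hcoset i, Finset.sum_sub_distrib, ← Finset.mul_sum,
      Finset.sum_boole, hN, Set.ncard_eq_toFinset_card', Set.toFinset_ofPred]
    simp [hf0, chi, FTr]
    ring
  refine ⟨walsh, forall_congr' fun b => ?_⟩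
  have hpos : (0 : ℤ) < 2 ^ m := by positivity
  rw [walsh, abs_mul, abs_of_pos hpos, mul_eq_left₀ hpos.ne', abs_eq zero_le_one]
  omega
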